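/- arXiv:2505.19210 — 4 statements merged into one kernel-verified Lean document; each statement's English description precedes it below -/
import Mathlib

section
/- Let Σ ∈ ℝ^{d×d} be symmetric positive semidefinite, μ ∈ ℝ^d, and σ > 0, and set W* = Σ(Σ+σ²I)^{-1} and b* = μ − W*μ (note Σ+σ²I is invertible). Then for every matrix W ∈ ℝ^{d×d} and vector b ∈ ℝ^d, ‖(W−I)μ+b‖² + tr((W−I)Σ(W−I)ᵀ) + σ²·tr(WWᵀ) ≥ tr((W*−I)Σ(W*−I)ᵀ) + σ²·tr(W*W*ᵀ), with equality if and only if W = W* and b = b*. Consequently the affine map x ↦ μ + Σ(Σ+σ²I)^{-1}(x−μ) is the unique minimizer of the affine denoising score-matching objective. -/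
open Matrix

/-- Completing the square around a critical point `M` of the regularized quadratic
`W ↦ tr((W - 1) C (W - 1)ᵀ) + s tr(W Wᵀ)`. -/
theorem trace_regularized_quadratic_eq_add {n : Type*} [Fintype n] [DecidableEq n]
    {C M : Matrix n n ℝ} {s : ℝ} (hC : Cᵀ = C) (hM : M * (C + s • 1) = C) (W : Matrix n n ℝ) :
    ((W - 1) * C * (W - 1)ᵀ).trace + s * (W * Wᵀ).trace =
      ((M - 1) * C * (M - 1)ᵀ).trace + s * (M * Mᵀ).trace
        + ((W - M) * C * (W - M)ᵀ).trace + s * ((W - M) * (W - M)ᵀ).trace := by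
  obtain ⟨E, rfl⟩ : ∃ E, W = M + E := ⟨W - M, by abel⟩
  have hcrit : (M - 1) * C + s • M = 0 := by
    rw [mul_add, mul_smul_comm, mul_one] at hM
    rw [sub_mul, one_mul, sub_add_eq_add_sub, hM, sub_self]
  have hcross : ((M - 1) * C * Eᵀ).trace + s * (M * Eᵀ).trace = 0 := by
    rw [← smul_eq_mul s, ← trace_smul, ← smul_mul_assoc, ← trace_add, ← add_mul, hcrit, zero_mul,
      trace_zero]
  have hquad : (E * C * (M - 1)ᵀ).trace = ((M - 1) * C * Eᵀ).trace := by
    rw [← trace_transpose]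
    simp only [transpose_mul, transpose_transpose, hC, Matrix.mul_assoc]
  have hreg : (E * Mᵀ).trace = (M * Eᵀ).trace := by
    rw [← trace_transpose, transpose_mul, transpose_transpose]
  rw [add_sub_cancel_left, add_sub_right_comm]
  simp only [transpose_add, add_mul, mul_add, trace_add, hquad, hreg]
  linear_combination 2 * hcross

/-- **The optimal affine denoiser.** For `Σ` symmetric PSD, `σ > 0`,
`W* = Σ(Σ+σ²I)⁻¹` and `b* = μ − W*μ`, the affine denoising objective
`‖(W−I)μ+b‖² + tr((W−I)Σ(W−I)ᵀ) + σ²·tr(WWᵀ)` is minimized uniquely at `(W*, b*)`,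
with minimum value `tr((W*−I)Σ(W*−I)ᵀ) + σ²·tr(W*W*ᵀ)`. -/
theorem optimal_affine_denoiser_unique_minimizer
    {d : ℕ} (Cov : Matrix (Fin d) (Fin d) ℝ) (hCov : Cov.PosSemidef)
    (μ : Fin d → ℝ) (σ : ℝ) (hσ : 0 < σ)
    (Wstar : Matrix (Fin d) (Fin d) ℝ) (hWstar : Wstar = Cov * (Cov + σ ^ 2 • 1)⁻¹)
    (bstar : Fin d → ℝ) (hbstar : bstar = μ - Wstar.mulVec μ) :
    ∀ (W : Matrix (Fin d) (Fin d) ℝ) (b : Fin d → ℝ),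
      ((Wstar - 1) * Cov * (Wstar - 1)ᵀ).trace + σ ^ 2 * (Wstar * Wstarᵀ).trace ≤
        (∑ i, ((W - 1).mulVec μ i + b i) ^ 2)
          + ((W - 1) * Cov * (W - 1)ᵀ).trace + σ ^ 2 * (W * Wᵀ).trace
      ∧ ((∑ i, ((W - 1).mulVec μ i + b i) ^ 2)
          + ((W - 1) * Cov * (W - 1)ᵀ).trace + σ ^ 2 * (W * Wᵀ).trace =
          ((Wstar - 1) * Cov * (Wstar - 1)ᵀ).trace + σ ^ 2 * (Wstar * Wstarᵀ).trace
          ↔ W = Wstar ∧ b = bstar) := by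
  intro W b
  have hs : 0 < σ ^ 2 := pow_pos hσ 2
  have hunit : IsUnit (Cov + σ ^ 2 • (1 : Matrix (Fin d) (Fin d) ℝ)) :=
    (PosDef.posSemidef_add hCov (PosDef.one.smul hs)).isUnit
  have hcrit : Wstar * (Cov + σ ^ 2 • 1) = Cov := by
    rw [hWstar, nonsing_inv_mul_cancel_right _ _ ((isUnit_iff_isUnit_det _).mp hunit)]
  have hsymm : Covᵀ = Cov := by
    simpa only [conjTranspose_eq_transpose_of_trivial] using hCov.isHermitian.eq
  have hsquare := trace_regularized_quadratic_eq_add hsymm hcrit W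
  have hmean : 0 ≤ ∑ i, ((W - 1).mulVec μ i + b i) ^ 2 :=
    Finset.sum_nonneg fun i _ => sq_nonneg _
  have hquad : 0 ≤ ((W - Wstar) * Cov * (W - Wstar)ᵀ).trace := by
    simpa only [conjTranspose_eq_transpose_of_trivial] using
      (hCov.mul_mul_conjTranspose_same (W - Wstar)).trace_nonneg
  have hnorm : 0 ≤ ((W - Wstar) * (W - Wstar)ᵀ).trace := by
    simpa only [conjTranspose_eq_transpose_of_trivial] using
      (posSemidef_self_mul_conjTranspose (W - Wstar)).trace_nonneg
  have hreg := mul_nonneg hs.le hnorm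
  refine ⟨by linarith, fun heq => ?_, ?_⟩
  · have hW : W = Wstar := by
      have hzero : ((W - Wstar) * (W - Wstar)ᵀ).trace = 0 :=
        (mul_eq_zero.mp (by linarith : σ ^ 2 * _ = 0)).resolve_left hs.ne'
      rw [← conjTranspose_eq_transpose_of_trivial,
        trace_mul_conjTranspose_self_eq_zero_iff] at hzero
      exact sub_eq_zero.mp hzero
    refine ⟨hW, funext fun i => ?_⟩
    have hsum : ∑ i, ((W - 1).mulVec μ i + b i) ^ 2 = 0 := by linarith
    have hi := (Finset.sum_eq_zero_iff_of_nonneg fun i _ => sq_nonneg _).mp hsum i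
      (Finset.mem_univ i)
    rw [sq_eq_zero_iff, sub_mulVec, one_mulVec, Pi.sub_apply, hW] at hi
    rw [hbstar, Pi.sub_apply]
    linarith
  · rintro ⟨rfl, rfl⟩
    simp [hbstar, sub_mulVec]
end

section
/- Let U = (u₁,…,u_d) be an orthonormal basis of ℝ^d, λ₁,…,λ_d ≥ 0, μ ∈ ℝ^d, σ_T > 0 and x_T ∈ ℝ^d. Define x(σ) = μ + Σ_{i=1}^d √((λ_i+σ²)/(λ_i+σ_T²)) · ⟨u_i, x_T−μ⟩ · u_i for σ > 0. Then x(σ_T) = x_T and, for every σ > 0, x is differentiable at σ with derivative x′(σ) = (1/σ) · (I − UΛ̃_σUᵀ)(x(σ)−μ), where UΛ̃_σUᵀ = Σ_i (λ_i/(λ_i+σ²)) u_i u_iᵀ. Equivalently, x solves the reverse diffusion ODE dx = −σ·∇log p(x;σ)dσ driven by the optimal linear denoiser D_L(x;σ) = μ + UΛ̃_σUᵀ(x−μ). -/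
open Matrix in
/-- A vector is the sum of its components along an orthonormal family of full size. -/
theorem sum_dotProduct_smul_of_orthonormal {n : Type*} [Fintype n] [DecidableEq n]
    {u : n → n → ℝ} (hu : ∀ i j, u i ⬝ᵥ u j = if i = j then (1 : ℝ) else 0) (v : n → ℝ) :
    ∑ i, (u i ⬝ᵥ v) • u i = v := by
  have h : (of u) * (of u)ᵀ = 1 := by
    ext i j
    rw [Matrix.one_apply, ← hu i j]
    rfl
  have h' : (of u)ᵀ *ᵥ (of u *ᵥ v) = v := by
    rw [mulVec_mulVec, mul_eq_one_comm.mp h, one_mulVec]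
  rw [mulVec_transpose, vecMul_eq_sum] at h'
  exact h'

open Matrix in
/-- The coefficients of a combination of orthonormal vectors are its inner products with them. -/
theorem dotProduct_sum_smul_of_orthonormal {n m : Type*} [Fintype n] [Fintype m] [DecidableEq m]
    {u : m → n → ℝ} (hu : ∀ i j, u i ⬝ᵥ u j = if i = j then (1 : ℝ) else 0) (c : m → ℝ) (i : m) :
    u i ⬝ᵥ ∑ j, c j • u j = c i := by
  simp [dotProduct_sum, hu]

theorem hasDerivAt_sqrt_add_sq_div {l T σ : ℝ} (hl : 0 ≤ l) (hT : 0 < T) (hσ : 0 < σ) :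
    HasDerivAt (fun s : ℝ => √((l + s ^ 2) / (l + T ^ 2)))
      (1 / σ * (√((l + σ ^ 2) / (l + T ^ 2))
        - l / (l + σ ^ 2) * √((l + σ ^ 2) / (l + T ^ 2)))) σ := by
  have hs : 0 < l + σ ^ 2 := by positivity
  have ht : 0 < l + T ^ 2 := by positivity
  have hq : 0 < (l + σ ^ 2) / (l + T ^ 2) := by positivity
  have h := ((((hasDerivAt_id σ).pow 2).const_add l).div_const (l + T ^ 2)).sqrt hq.ne'
  refine h.congr_deriv ?_
  have hr := Real.sqrt_pos.mpr hq
  have hr2 : √((l + σ ^ 2) / (l + T ^ 2)) ^ 2 * (l + T ^ 2) = l + σ ^ 2 := by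
    rw [Real.sq_sqrt hq.le]
    field_simp
  simp only [id, Pi.pow_apply]
  generalize √((l + σ ^ 2) / (l + T ^ 2)) = r at hr hr2 ⊢
  rw [← sub_eq_zero]
  field_simp
  norm_num
  linear_combination (-2 * σ ^ 2) * hr2


/-- **Closed-form solution of the naive linear reverse diffusion ODE.**
With an orthonormal basis `(uᵢ)` of `ℝ^d`, eigenvalues `λᵢ ≥ 0`, mean `μ`, initial noise
level `σ_T > 0` and initial point `x_T`, the curve
`x(σ) = μ + Σᵢ √((λᵢ+σ²)/(λᵢ+σ_T²))·⟨uᵢ, x_T−μ⟩·uᵢ`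
satisfies `x(σ_T) = x_T` and solves the reverse probability-flow ODE
`x′(σ) = (1/σ)·(I − UΛ̃_σUᵀ)(x(σ)−μ)` of the optimal linear denoiser. -/
theorem naive_linear_reverse_ode_solution
    {d : ℕ} (u : Fin d → (Fin d → ℝ))
    (hu : ∀ i j, (∑ k, u i k * u j k) = if i = j then (1 : ℝ) else 0)
    (lam : Fin d → ℝ) (hlam : ∀ i, 0 ≤ lam i)
    (μ : Fin d → ℝ) (σT : ℝ) (hσT : 0 < σT) (xT : Fin d → ℝ)
    (x : ℝ → (Fin d → ℝ))
    (hx : ∀ σ : ℝ, x σ = μ + ∑ i,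
      (Real.sqrt ((lam i + σ ^ 2) / (lam i + σT ^ 2)) * (∑ k, u i k * (xT k - μ k))) • u i) :
    x σT = xT ∧
      ∀ σ : ℝ, 0 < σ →
        HasDerivAt x
          ((1 / σ) • ((x σ - μ) -
            ∑ i, ((lam i / (lam i + σ ^ 2)) * (∑ k, u i k * (x σ k - μ k))) • u i)) σ := by
  have hu' : ∀ i j, u i ⬝ᵥ u j = if i = j then (1 : ℝ) else 0 := hu
  refine ⟨?_, fun σ hσ => ?_⟩
  · have h1 : ∀ i, √((lam i + σT ^ 2) / (lam i + σT ^ 2)) = 1 := fun i => by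
      have := hlam i
      rw [div_self (by positivity), Real.sqrt_one]
    have h2 : ∑ i, (∑ k, u i k * (xT k - μ k)) • u i = xT - μ :=
      sum_dotProduct_smul_of_orthonormal hu' (xT - μ)
    simp only [hx, h1, one_mul, h2, add_sub_cancel]
  · have hsub : x σ - μ = ∑ i,
        (√((lam i + σ ^ 2) / (lam i + σT ^ 2)) * (∑ k, u i k * (xT k - μ k))) • u i := by
      rw [hx, add_sub_cancel_left]
    have hcoef : ∀ i, ∑ k, u i k * (x σ k - μ k) =
        √((lam i + σ ^ 2) / (lam i + σT ^ 2)) * (∑ k, u i k * (xT k - μ k)) := fun i => by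
      change u i ⬝ᵥ (x σ - μ) = _
      rw [hsub, dotProduct_sum_smul_of_orthonormal hu']
    have hderiv := (HasDerivAt.fun_sum (u := Finset.univ) fun i _ =>
      ((hasDerivAt_sqrt_add_sq_div (hlam i) hσT hσ).mul_const
        (∑ k, u i k * (xT k - μ k))).smul_const (u i)).const_add μ
    refine (hderiv.congr_of_eventuallyEq (.of_forall hx)).congr_deriv ?_
    simp only [hcoef]
    rw [hsub, ← Finset.sum_sub_distrib, Finset.smul_sum]
    refine Finset.sum_congr rfl fun i _ => ?_
    rw [← sub_smul, smul_smul]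
    congr 1
    ring
end

section
/- Fix λ_c, λ_uc ≥ 0, γ ∈ ℝ, σ_T > 0 and c_T ∈ ℝ. Define ĉ(σ) = (((λ_c+σ²)(λ_uc+σ_T²))/((λ_c+σ_T²)(λ_uc+σ²)))^{γ/2} · √((λ_c+σ²)/(λ_c+σ_T²)) · c_T for σ > 0. Then ĉ(σ_T) = c_T and, for every σ > 0, ĉ is differentiable at σ with ĉ′(σ) = [σ/(λ_c+σ²) − γ·σ·(λ_c−λ_uc)/((λ_c+σ²)(λ_uc+σ²))] · ĉ(σ). -/
/-- Taking a real power multiplies the logarithmic derivative by the exponent. -/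
theorem HasDerivAt.rpow_const_of_logDeriv {f : ℝ → ℝ} {l x : ℝ} (p : ℝ)
    (hf : HasDerivAt f (l * f x) x) (hx : 0 < f x) :
    HasDerivAt (fun y => f y ^ p) (p * l * f x ^ p) x := by
  convert hf.rpow_const (p := p) (Or.inl hx.ne') using 1
  rw [Real.rpow_sub_one hx.ne']
  field_simp

/-- **Homogeneous solution of the per-component CFG-guided reverse diffusion ODE.**
For `λ_c, λ_uc ≥ 0`, `γ ∈ ℝ`, `σ_T > 0` and `c_T ∈ ℝ`, the function
`ĉ(σ) = (((λ_c+σ²)(λ_uc+σ_T²))/((λ_c+σ_T²)(λ_uc+σ²)))^{γ/2}·√((λ_c+σ²)/(λ_c+σ_T²))·c_T`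
satisfies `ĉ(σ_T) = c_T` and, for every `σ > 0`,
`ĉ′(σ) = [σ/(λ_c+σ²) − γσ(λ_c−λ_uc)/((λ_c+σ²)(λ_uc+σ²))]·ĉ(σ)`. -/
theorem cfg_homogeneous_ode_component_solution
    (lamc lamuc : ℝ) (hlamc : 0 ≤ lamc) (hlamuc : 0 ≤ lamuc)
    (γ : ℝ) (σT cT : ℝ) (hσT : 0 < σT)
    (c : ℝ → ℝ)
    (hc : ∀ σ : ℝ, c σ =
      (((lamc + σ ^ 2) * (lamuc + σT ^ 2)) /
        ((lamc + σT ^ 2) * (lamuc + σ ^ 2))) ^ (γ / 2) *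
      Real.sqrt ((lamc + σ ^ 2) / (lamc + σT ^ 2)) * cT) :
    c σT = cT ∧
      ∀ σ : ℝ, 0 < σ →
        HasDerivAt c
          ((σ / (lamc + σ ^ 2) -
            γ * σ * (lamc - lamuc) / ((lamc + σ ^ 2) * (lamuc + σ ^ 2))) * c σ) σ := by
  have pos : ∀ l s : ℝ, 0 ≤ l → 0 < s → 0 < l + s ^ 2 := fun l s hl hs => by positivity
  have hcT := pos lamc σT hlamc hσT
  have huT := pos lamuc σT hlamuc hσT
  refine ⟨?_, fun σ hσ => ?_⟩
  · rw [hc, div_self (mul_pos hcT huT).ne', div_self hcT.ne']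
    simp
  have hcσ := pos lamc σ hlamc hσ
  have huσ := pos lamuc σ hlamuc hσ
  have deriv_add_sq : ∀ l : ℝ, HasDerivAt (fun s : ℝ => l + s ^ 2) (2 * σ) σ := fun l => by
    simpa using (hasDerivAt_pow 2 σ).const_add l
  have hratio : HasDerivAt
      (fun s => (lamc + s ^ 2) * (lamuc + σT ^ 2) / ((lamc + σT ^ 2) * (lamuc + s ^ 2)))
      ((2 * σ / (lamc + σ ^ 2) - 2 * σ / (lamuc + σ ^ 2)) *
        ((lamc + σ ^ 2) * (lamuc + σT ^ 2) / ((lamc + σT ^ 2) * (lamuc + σ ^ 2)))) σ := by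
    refine (((deriv_add_sq lamc).mul_const (lamuc + σT ^ 2)).fun_div
      ((deriv_add_sq lamuc).const_mul (lamc + σT ^ 2)) (mul_pos hcT huσ).ne').congr_deriv ?_
    field_simp
  have hscale : HasDerivAt (fun s => (lamc + s ^ 2) / (lamc + σT ^ 2))
      (2 * σ / (lamc + σ ^ 2) * ((lamc + σ ^ 2) / (lamc + σT ^ 2))) σ := by
    refine ((deriv_add_sq lamc).div_const (lamc + σT ^ 2)).congr_deriv ?_
    field_simp
  have hprod := ((hratio.rpow_const_of_logDeriv (γ / 2) (by positivity)).fun_mul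
    (hscale.rpow_const_of_logDeriv (1 / 2) (by positivity))).mul_const cT
  simp only [Real.sqrt_eq_rpow] at hc
  rw [funext hc]
  refine hprod.congr_deriv ?_
  beta_reduce
  generalize ((lamc + σ ^ 2) * (lamuc + σT ^ 2) /
    ((lamc + σT ^ 2) * (lamuc + σ ^ 2))) ^ (γ / 2) = A
  generalize ((lamc + σ ^ 2) / (lamc + σT ^ 2)) ^ (1 / 2 : ℝ) = B
  field_simp
  ring
end

section
/- Fix λ_c, λ_uc ≥ 0, γ ∈ ℝ, σ_T > 0, c_T ∈ ℝ and m ∈ ℝ. Let ĉ(σ) = (((λ_c+σ²)(λ_uc+σ_T²))/((λ_c+σ_T²)(λ_uc+σ²)))^{γ/2}·√((λ_c+σ²)/(λ_c+σ_T²))·c_T, and define c(σ) = ĉ(σ) + γ·(λ_c+σ²)^{1/2}·((λ_c+σ²)/(λ_uc+σ²))^{γ/2} · ∫_σ^{σ_T} (λ_uc+s²)^{γ/2−1}·(λ_c+s²)^{−(γ+1)/2}·s·m ds for σ ∈ (0, σ_T]. Then c(σ_T) = c_T and, for every σ ∈ (0, σ_T], c is differentiable at σ with c′(σ) = [σ/(λ_c+σ²)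 − γ·σ·(λ_c−λ_uc)/((λ_c+σ²)(λ_uc+σ²))]·c(σ) − γ·(σ/(λ_uc+σ²))·m. -/
theorem hasDerivAt_add_sq_rpow {a x : ℝ} (ha : 0 ≤ a) (hx : 0 < x) (p : ℝ) :
    HasDerivAt (fun y : ℝ => (a + y ^ 2) ^ p)
      (2 * p * x / (a + x ^ 2) * (a + x ^ 2) ^ p) x := by
  have hpos : 0 < a + x ^ 2 := by positivity
  have h : HasDerivAt (fun y : ℝ => a + y ^ 2) (2 * x) x := by
    simpa using (hasDerivAt_pow 2 x).const_add a
  convert h.rpow_const (p := p) (Or.inl hpos.ne') using 1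
  rw [Real.rpow_sub_one hpos.ne']
  field_simp

/-- The fundamental solution `(a + x²)^((γ+1)/2) (b + x²)^(-γ/2)` of the homogeneous equation. -/
noncomputable def cfgFundamental (a b γ x : ℝ) : ℝ :=
  (a + x ^ 2) ^ ((γ + 1) / 2) * (b + x ^ 2) ^ (-(γ / 2))

theorem cfgFundamental_pos {a b x : ℝ} (ha : 0 ≤ a) (hb : 0 ≤ b) (hx : 0 < x) (γ : ℝ) :
    0 < cfgFundamental a b γ x := by
  unfold cfgFundamental
  positivity

theorem hasDerivAt_cfgFundamental {a b x : ℝ} (ha : 0 ≤ a) (hb : 0 ≤ b) (hx : 0 < x) (γ : ℝ) :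
    HasDerivAt (cfgFundamental a b γ)
      ((x / (a + x ^ 2) - γ * x * (a - b) / ((a + x ^ 2) * (b + x ^ 2))) *
        cfgFundamental a b γ x) x := by
  have hA : 0 < a + x ^ 2 := by positivity
  have hB : 0 < b + x ^ 2 := by positivity
  refine ((hasDerivAt_add_sq_rpow ha hx ((γ + 1) / 2)).mul
    (hasDerivAt_add_sq_rpow hb hx (-(γ / 2)))).congr_deriv ?_
  unfold cfgFundamental
  field_simp
  ring

theorem sqrt_mul_div_rpow_eq_cfgFundamental {a b x : ℝ} (ha : 0 ≤ a) (hb : 0 ≤ b) (hx : 0 < x)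
    (γ : ℝ) :
    (a + x ^ 2) ^ ((1 : ℝ) / 2) * ((a + x ^ 2) / (b + x ^ 2)) ^ (γ / 2) =
      cfgFundamental a b γ x := by
  have hA : 0 < a + x ^ 2 := by positivity
  have hB : 0 < b + x ^ 2 := by positivity
  rw [cfgFundamental, Real.div_rpow hA.le hB.le, Real.rpow_neg hB.le, ← div_eq_mul_inv,
    ← mul_div_assoc, ← Real.rpow_add hA, ← add_div, add_comm 1 γ]

theorem div_rpow_mul_sqrt_eq_cfgFundamental_div {a b x y : ℝ} (ha : 0 ≤ a) (hb : 0 ≤ b)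
    (hx : 0 < x) (hy : 0 < y) (γ : ℝ) :
    (((a + x ^ 2) * (b + y ^ 2)) / ((a + y ^ 2) * (b + x ^ 2))) ^ (γ / 2) *
      Real.sqrt ((a + x ^ 2) / (a + y ^ 2)) =
      cfgFundamental a b γ x / cfgFundamental a b γ y := by
  have hAx : 0 < a + x ^ 2 := by positivity
  have hBx : 0 < b + x ^ 2 := by positivity
  have hAy : 0 < a + y ^ 2 := by positivity
  have hBy : 0 < b + y ^ 2 := by positivity
  rw [← sqrt_mul_div_rpow_eq_cfgFundamental ha hb hx,
    ← sqrt_mul_div_rpow_eq_cfgFundamental ha hb hy,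
    mul_div_mul_comm ((a + x ^ 2) ^ ((1 : ℝ) / 2)), ← Real.div_rpow hAx.le hAy.le,
    ← Real.div_rpow (by positivity) (by positivity),
    Real.sqrt_eq_rpow, mul_comm, div_div_div_eq, mul_comm (b + x ^ 2) (a + y ^ 2)]

theorem cfgFundamental_mul_forcing {a b x : ℝ} (ha : 0 ≤ a) (hb : 0 ≤ b) (hx : 0 < x)
    (γ m : ℝ) :
    cfgFundamental a b γ x *
      ((b + x ^ 2) ^ (γ / 2 - 1) * (a + x ^ 2) ^ (-(γ + 1) / 2) * x * m) =
      x / (b + x ^ 2) * m := by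
  have hA : 0 < a + x ^ 2 := by positivity
  have hB : 0 < b + x ^ 2 := by positivity
  rw [cfgFundamental, neg_div, Real.rpow_neg hA.le, Real.rpow_neg hB.le,
    Real.rpow_sub_one hB.ne']
  have h₁ := (Real.rpow_pos_of_pos hA ((γ + 1) / 2)).ne'
  have h₂ := (Real.rpow_pos_of_pos hB (γ / 2)).ne'
  field_simp

theorem hasDerivAt_integral_left_of_continuousOn_Ioi {f : ℝ → ℝ}
    (hf : ContinuousOn f (Set.Ioi 0)) {x y : ℝ} (hx : 0 < x) (hy : 0 < y) :
    HasDerivAt (fun u => ∫ s in u..y, f s) (-f x) x := by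
  refine intervalIntegral.integral_hasDerivAt_left ?_ ?_ ?_
  · refine (hf.mono fun s hs => ?_).intervalIntegrable
    exact (lt_min hx hy).trans_le hs.1
  · exact hf.stronglyMeasurableAtFilter isOpen_Ioi x hx
  · exact hf.continuousAt (Ioi_mem_nhds hx)


/-- **Per-component solution of the non-homogeneous CFG-guided reverse diffusion ODE.**
With `ĉ` the homogeneous solution and mean-shift component `m`, the function
`c(σ) = ĉ(σ) + γ(λ_c+σ²)^{1/2}((λ_c+σ²)/(λ_uc+σ²))^{γ/2}·
  ∫_σ^{σ_T}(λ_uc+s²)^{γ/2−1}(λ_c+s²)^{−(γ+1)/2}·s·m ds`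
satisfies `c(σ_T) = c_T` and, for every `σ ∈ (0, σ_T]`,
`c′(σ) = [σ/(λ_c+σ²) − γσ(λ_c−λ_uc)/((λ_c+σ²)(λ_uc+σ²))]·c(σ) − γ(σ/(λ_uc+σ²))·m`. -/
theorem cfg_nonhomogeneous_ode_component_solution
    (lamc lamuc : ℝ) (hlamc : 0 ≤ lamc) (hlamuc : 0 ≤ lamuc)
    (γ : ℝ) (σT cT m : ℝ) (hσT : 0 < σT)
    (chat : ℝ → ℝ)
    (hchat : ∀ σ : ℝ, chat σ =
      (((lamc + σ ^ 2) * (lamuc + σT ^ 2)) /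
        ((lamc + σT ^ 2) * (lamuc + σ ^ 2))) ^ (γ / 2) *
      Real.sqrt ((lamc + σ ^ 2) / (lamc + σT ^ 2)) * cT)
    (c : ℝ → ℝ)
    (hc : ∀ σ : ℝ, c σ = chat σ +
      γ * (lamc + σ ^ 2) ^ ((1 : ℝ) / 2) *
        ((lamc + σ ^ 2) / (lamuc + σ ^ 2)) ^ (γ / 2) *
        ∫ s in σ..σT,
          (lamuc + s ^ 2) ^ (γ / 2 - 1) * (lamc + s ^ 2) ^ (-(γ + 1) / 2) * s * m) :
    c σT = cT ∧
      ∀ σ : ℝ, σ ∈ Set.Ioc 0 σT →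
        HasDerivAt c
          ((σ / (lamc + σ ^ 2) -
              γ * σ * (lamc - lamuc) / ((lamc + σ ^ 2) * (lamuc + σ ^ 2))) * c σ -
            γ * (σ / (lamuc + σ ^ 2)) * m) σ := by
  have hsol : ∀ x : ℝ, 0 < x → c x = cfgFundamental lamc lamuc γ x *
      (cT / cfgFundamental lamc lamuc γ σT + γ * ∫ s in x..σT,
        (lamuc + s ^ 2) ^ (γ / 2 - 1) * (lamc + s ^ 2) ^ (-(γ + 1) / 2) * s * m) := by
    intro x hx
    rw [hc, hchat, div_rpow_mul_sqrt_eq_cfgFundamental_div hlamc hlamuc hx hσT, mul_assoc γ,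
      sqrt_mul_div_rpow_eq_cfgFundamental hlamc hlamuc hx]
    ring
  refine ⟨?_, fun σ hσ => ?_⟩
  · rw [hsol σT hσT, intervalIntegral.integral_same, mul_zero, add_zero,
      mul_div_cancel₀ _ (cfgFundamental_pos hlamc hlamuc hσT γ).ne']
  · have hpos : 0 < σ := hσ.1
    have hcont : ContinuousOn (fun s : ℝ => (lamuc + s ^ 2) ^ (γ / 2 - 1) *
        (lamc + s ^ 2) ^ (-(γ + 1) / 2) * s * m) (Set.Ioi 0) := by
      intro s hs
      have hcu := (hasDerivAt_add_sq_rpow hlamuc hs (γ / 2 - 1)).continuousAt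
      have hcc := (hasDerivAt_add_sq_rpow hlamc hs (-(γ + 1) / 2)).continuousAt
      exact (((hcu.mul hcc).mul continuousAt_id).mul continuousAt_const).continuousWithinAt
    have hint := hasDerivAt_integral_left_of_continuousOn_Ioi hcont hpos hσT
    have hderiv := (hasDerivAt_cfgFundamental hlamc hlamuc hpos γ).mul
      ((hint.const_mul γ).const_add (cT / cfgFundamental lamc lamuc γ σT))
    refine (hderiv.congr_of_eventuallyEq ?_).congr_deriv ?_
    · filter_upwards [Ioi_mem_nhds hpos] with x hx using hsol x hx
    · rw [hsol σ hpos]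
      linear_combination (-γ) * cfgFundamental_mul_forcing hlamc hlamuc hpos γ m
end
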